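/- For all real α > -1 and -1 < β ≤ 0, and for every integer n ≥ 1, the integration-by-parts identity ∫₀¹ (h(1)-h(r))·r^{β+n}(1-r)^α dr = (n/2)·∫₀¹ (h(1)-h(r))²·r^{n-1} dr holds. -/

import Mathlib

open MeasureTheory Real Filter

/-- The incomplete beta function h(r) = ∫₀^r t^β (1-t)^α dt. -/
noncomputable def hfun (α β : ℝ) (r : ℝ) : ℝ := ∫ t in (0:ℝ)..r, t ^ β * (1 - t) ^ α

theorem intervalIntegrable_rpow_mul_one_sub_rpow_left {β : ℝ} (hβ : -1 < β) (α : ℝ) :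
    IntervalIntegrable (fun t : ℝ => t ^ β * (1 - t) ^ α) volume 0 (1 / 2) := by
  refine (intervalIntegral.intervalIntegrable_rpow' hβ).mul_continuousOn ?_
  refine ContinuousOn.rpow_const (by fun_prop) fun t ht => Or.inl ?_
  rw [Set.uIcc_of_le (by norm_num)] at ht
  linarith [ht.2]

theorem intervalIntegrable_rpow_mul_one_sub_rpow {α β : ℝ} (hα : -1 < α) (hβ : -1 < β) :
    IntervalIntegrable (fun t : ℝ => t ^ β * (1 - t) ^ α) volume 0 1 := by
  refine (intervalIntegrable_rpow_mul_one_sub_rpow_left hβ α).trans ?_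
  have h := ((intervalIntegrable_rpow_mul_one_sub_rpow_left hα β).comp_sub_left 1).symm
  norm_num at h
  simpa only [mul_comm, one_div] using h

theorem continuousOn_hfun {α β : ℝ} (hα : -1 < α) (hβ : -1 < β) :
    ContinuousOn (hfun α β) (Set.uIcc 0 1) := by
  refine intervalIntegral.continuousOn_primitive_interval ?_
  rw [Set.uIcc_of_le zero_le_one]
  exact (intervalIntegrable_iff_integrableOn_Icc_of_le zero_le_one enorm_ne_top).1
    (intervalIntegrable_rpow_mul_one_sub_rpow hα hβ)

theorem hasDerivAt_hfun {α β r : ℝ} (hα : -1 < α) (hβ : -1 < β) (hr0 : 0 < r) (hr1 : r < 1) :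
    HasDerivAt (hfun α β) (r ^ β * (1 - r) ^ α) r := by
  refine intervalIntegral.integral_hasDerivAt_right ?_ ?_ ?_
  · refine (intervalIntegrable_rpow_mul_one_sub_rpow hα hβ).mono_set ?_
    rw [Set.uIcc_of_le hr0.le, Set.uIcc_of_le zero_le_one]
    exact Set.Icc_subset_Icc_right hr1.le
  · have hm : Measurable fun t : ℝ => t ^ β * (1 - t) ^ α := by fun_prop
    exact hm.stronglyMeasurable.stronglyMeasurableAtFilter
  · exact (continuousAt_id.rpow_const (Or.inl hr0.ne')).mul
      (ContinuousAt.rpow_const (by fun_prop) (Or.inl (sub_pos.2 hr1).ne'))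

/-- Integration by parts: for n ≥ 1,
∫₀¹ (h(1)-h(r))·r^{β+n}(1-r)^α dr = (n/2)·∫₀¹ (h(1)-h(r))²·r^{n-1} dr. -/
theorem parts_identity_linear (α β : ℝ) (hα : -1 < α) (hβ1 : -1 < β) (hβ2 : β ≤ 0)
    (n : ℕ) (hn : 1 ≤ n) :
    ∫ r in (0:ℝ)..1, (hfun α β 1 - hfun α β r) * r ^ (β + (n:ℝ)) * (1 - r) ^ α
      = ((n:ℝ) / 2) * ∫ r in (0:ℝ)..1, (hfun α β 1 - hfun α β r) ^ 2 * r ^ ((n:ℝ) - 1) := by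
  have hg : ContinuousOn (fun r => hfun α β 1 - hfun α β r) (Set.uIcc 0 1) :=
    continuousOn_const.sub (continuousOn_hfun hα hβ1)
  have hparts := intervalIntegral.integral_mul_deriv_eq_deriv_mul_of_hasDerivAt
    (a := 0) (b := 1)
    (u := fun r => (hfun α β 1 - hfun α β r) ^ 2) (v := fun r => r ^ n)
    (u' := fun r => 2 * (hfun α β 1 - hfun α β r) * -(r ^ β * (1 - r) ^ α))
    (v' := fun r => n * r ^ (n - 1)) (hg.pow 2) (by fun_prop)
    (fun r hr => by
      rw [min_eq_left zero_le_one, max_eq_right zero_le_one] at hr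
      simpa using ((hasDerivAt_hfun hα hβ1 hr.1 hr.2).const_sub (hfun α β 1)).fun_pow 2)
    (fun r _ => hasDerivAt_pow n r)
    ((intervalIntegrable_rpow_mul_one_sub_rpow hα hβ1).neg.continuousOn_mul
      (continuousOn_const.mul hg))
    (Continuous.intervalIntegrable (by fun_prop) _ _)
  have hleft : ∫ r in (0:ℝ)..1,
      2 * (hfun α β 1 - hfun α β r) * -(r ^ β * (1 - r) ^ α) * r ^ n
      = -2 * ∫ r in (0:ℝ)..1,
        (hfun α β 1 - hfun α β r) * r ^ (β + (n:ℝ)) * (1 - r) ^ α := by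
    rw [← intervalIntegral.integral_const_mul]
    refine intervalIntegral.integral_congr_ae (ae_of_all _ fun r hr => ?_)
    rw [Set.uIoc_of_le zero_le_one] at hr
    rw [rpow_add_natCast hr.1.ne']
    ring
  have hright : ∫ r in (0:ℝ)..1, (hfun α β 1 - hfun α β r) ^ 2 * (n * r ^ (n - 1))
      = n * ∫ r in (0:ℝ)..1, (hfun α β 1 - hfun α β r) ^ 2 * r ^ ((n:ℝ) - 1) := by
    rw [← intervalIntegral.integral_const_mul]
    refine intervalIntegral.integral_congr fun r _ => ?_
    have hpow : r ^ ((n:ℝ) - 1) = r ^ (n - 1) := by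
      rw [← rpow_natCast, Nat.cast_sub hn, Nat.cast_one]
    simp only [hpow]
    ring
  have hn0 : n ≠ 0 := Nat.one_le_iff_ne_zero.1 hn
  simp only [hleft, hright, sub_self, ne_eq, OfNat.ofNat_ne_zero, not_false_eq_true, zero_pow,
    hn0, zero_mul, mul_zero] at hparts
  linarith
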